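/- arXiv:1903.07894 — 4 statements merged into one kernel-verified Lean document; each statement's English description precedes it below -/
import Mathlib

section
/- Let N ≥ 3 be an integer and let q ∈ (1,2) be a real number. Then N(q-1)/q ≤ qN/(N-q+1) if and only if q ≤ Q_N. -/
/-- `Q n = 2` if `n ≤ 4`, and `Q n = (n + 2 - √(n² - 4n - 4))/4` if `n ≥ 5`. -/
noncomputable def Q (n : ℕ) : ℝ :=
  if n ≤ 4 then 2 else ((n : ℝ) + 2 - Real.sqrt ((n : ℝ) ^ 2 - 4 * n - 4)) / 4

/-- For an integer `N ≥ 3` and a real `q ∈ (1,2)`,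
`N(q-1)/q ≤ qN/(N-q+1)` if and only if `q ≤ Q N`. -/
theorem stmt_1 (N : ℕ) (hN : 3 ≤ N) (q : ℝ) (hq1 : 1 < q) (hq2 : q < 2) :
    (N : ℝ) * (q - 1) / q ≤ q * N / ((N : ℝ) - q + 1) ↔ q ≤ Q N := by
  have hN' : (3 : ℝ) ≤ N := by exact_mod_cast hN
  have hquad : (N : ℝ) * (q - 1) / q ≤ q * N / ((N : ℝ) - q + 1) ↔
      0 ≤ 2 * q ^ 2 - (N + 2) * q + (N + 1) := by
    rw [div_le_div_iff₀ (by linarith) (by linarith), ← sub_nonneg,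
      show q * N * q - (N : ℝ) * (q - 1) * (N - q + 1) =
        N * (2 * q ^ 2 - (N + 2) * q + (N + 1)) by ring]
    exact mul_nonneg_iff_of_pos_left (by linarith)
  rw [hquad, Q]
  split_ifs with h
  · have h4 : (N : ℝ) ≤ 4 := by exact_mod_cast h
    exact iff_of_true (by nlinarith [sq_nonneg (2 * q - 3)]) hq2.le
  · have h5 : (5 : ℝ) ≤ N := by exact_mod_cast not_le.mp h
    have hdisc : (1 : ℝ) ≤ (N : ℝ) ^ 2 - 4 * N - 4 := by nlinarith
    have hsq := Real.sq_sqrt (zero_le_one.trans hdisc)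
    have hs := Real.one_le_sqrt.mpr hdisc
    set s := Real.sqrt ((N : ℝ) ^ 2 - 4 * N - 4)
    rw [show 2 * q ^ 2 - ((N : ℝ) + 2) * q + (N + 1) =
        2 * ((N + 2 + s) / 4 - q) * ((N + 2 - s) / 4 - q) by linear_combination hsq / 8,
      mul_nonneg_iff_of_pos_left (by linarith), sub_nonneg]
end

section
/- Let σ ∈ (0,1] and define z(s) = (1+σs)²/(1+s)^{4-2σ} and y(s) = e^{-s²/2}·∫₀^s e^{t²/2} z(t) dt for s ≥ 0. Then y is differentiable on [0,∞) with y'(s) + s·y(s) = z(s) for all s ≥ 0, and there exists a constant C > 0 such that y(s) ≤ C·z(s) for all s ≥ 0. -/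
open Set

/-- The logarithmic derivative of a quadratic factor divided by a real power. -/
lemma hasDerivAt_sq_div_rpow {σ p s : ℝ} (hσs : 0 < 1 + σ * s) (hs : 0 < 1 + s) :
    HasDerivAt (fun s : ℝ => (1 + σ * s) ^ 2 / (1 + s) ^ p)
      ((1 + σ * s) ^ 2 / (1 + s) ^ p * (2 * σ / (1 + σ * s) - p / (1 + s))) s := by
  have hnum : HasDerivAt (fun s : ℝ => (1 + σ * s) ^ 2) (2 * (1 + σ * s) * σ) s := by
    simpa using (((hasDerivAt_id s).const_mul σ).const_add 1).fun_pow 2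
  have hden : HasDerivAt (fun s : ℝ => (1 + s) ^ p) (p * ((1 + s) ^ p / (1 + s))) s := by
    have h := ((hasDerivAt_id s).const_add 1).rpow_const (p := p) (Or.inl hs.ne')
    simpa [Real.rpow_sub_one hs.ne'] using h
  have hpow : 0 < (1 + s) ^ p := Real.rpow_pos_of_pos hs p
  refine (hnum.fun_div hden hpow.ne').congr_deriv ?_
  field_simp

lemma hasDerivAt_exp_sq_div_two (s : ℝ) :
    HasDerivAt (fun t : ℝ => Real.exp (t ^ 2 / 2)) (Real.exp (s ^ 2 / 2) * s) s := by
  have h : HasDerivAt (fun t : ℝ => t ^ 2 / 2) s s := by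
    simpa using ((hasDerivAt_id s).pow 2).div_const 2
  exact h.exp

lemma hasDerivAt_exp_neg_sq_div_two (s : ℝ) :
    HasDerivAt (fun t : ℝ => Real.exp (-t ^ 2 / 2)) (Real.exp (-s ^ 2 / 2) * -s) s := by
  have h : HasDerivAt (fun t : ℝ => -t ^ 2 / 2) (-s) s := by
    have h' := ((hasDerivAt_id s).pow 2).neg.div_const 2
    refine h'.congr_deriv ?_
    simp [neg_div]
  exact h.exp

/-- The primitive of the weight `exp (t² / 2) * z t` solves the equation `y' + s y = z` after
multiplication by `exp (-s² / 2)`. -/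
lemma hasDerivAt_exp_mul_integral {z : ℝ → ℝ} {a b s : ℝ} (hz : ContinuousOn z (Ioi a))
    (hb : a < b) (hs : a < s) :
    HasDerivAt (fun s => Real.exp (-s ^ 2 / 2) * ∫ t in b..s, Real.exp (t ^ 2 / 2) * z t)
      (z s - s * (Real.exp (-s ^ 2 / 2) * ∫ t in b..s, Real.exp (t ^ 2 / 2) * z t)) s := by
  have hf : ContinuousOn (fun t => Real.exp (t ^ 2 / 2) * z t) (Ioi a) :=
    (by fun_prop : Continuous fun t : ℝ => Real.exp (t ^ 2 / 2)).continuousOn.mul hz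
  have hsub : uIcc b s ⊆ Ioi a := fun x hx => (lt_min hb hs).trans_le hx.1
  have hF : HasDerivAt (fun s => ∫ t in b..s, Real.exp (t ^ 2 / 2) * z t)
      (Real.exp (s ^ 2 / 2) * z s) s :=
    intervalIntegral.integral_hasDerivAt_right (hf.mono hsub).intervalIntegrable
      (hf.stronglyMeasurableAtFilter isOpen_Ioi s hs) (hf.continuousAt (Ioi_mem_nhds hs))
  have hexp : Real.exp (-s ^ 2 / 2) * Real.exp (s ^ 2 / 2) = 1 := by
    rw [← Real.exp_add]
    ring_nf
    exact Real.exp_zero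
  refine ((hasDerivAt_exp_neg_sq_div_two s).mul hF).congr_deriv ?_
  linear_combination z s * hexp

/-- Comparison principle: a supersolution of `y' + s y = z` dominating `y` at `a` dominates it
on `[a, ∞)`. -/
lemma le_of_hasDerivAt_add_mul_le {y w y' w' : ℝ → ℝ} {a : ℝ}
    (hy : ∀ s, a ≤ s → HasDerivAt y (y' s) s) (hw : ∀ s, a ≤ s → HasDerivAt w (w' s) s)
    (h : ∀ s, a ≤ s → y' s + s * y s ≤ w' s + s * w s) (ha : y a ≤ w a) {s : ℝ} (hs : a ≤ s) :
    y s ≤ w s := by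
  have hg : ∀ t, a ≤ t → HasDerivAt (fun t => Real.exp (t ^ 2 / 2) * (w t - y t))
      (Real.exp (t ^ 2 / 2) * t * (w t - y t) + Real.exp (t ^ 2 / 2) * (w' t - y' t)) t :=
    fun t ht => (hasDerivAt_exp_sq_div_two t).mul ((hw t ht).sub (hy t ht))
  have hmono : MonotoneOn (fun t => Real.exp (t ^ 2 / 2) * (w t - y t)) (Ici a) := by
    refine monotoneOn_of_hasDerivWithinAt_nonneg (convex_Ici a)
      (fun t ht => (hg t ht).continuousAt.continuousWithinAt)
      (fun t ht => (hg t (interior_subset ht)).hasDerivWithinAt) fun t ht => ?_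
    have hle := h t (interior_subset ht)
    have hpos : 0 ≤ Real.exp (t ^ 2 / 2) * ((w' t + t * w t) - (y' t + t * y t)) :=
      mul_nonneg (Real.exp_pos _).le (sub_nonneg.2 hle)
    linarith
  have h1 := hmono self_mem_Ici hs hs
  have h2 : 0 ≤ Real.exp (s ^ 2 / 2) * (w s - y s) :=
    (mul_nonneg (Real.exp_pos _).le (sub_nonneg.2 ha)).trans h1
  exact sub_nonneg.1 (nonneg_of_mul_nonneg_right h2 (Real.exp_pos _))


/-- Let `σ ∈ (0,1]`, `z(s) = (1+σs)²/(1+s)^{4-2σ}` and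
`y(s) = e^{-s²/2}·∫₀^s e^{t²/2} z(t) dt` for `s ≥ 0`. Then `y` satisfies
`y'(s) + s·y(s) = z(s)` for all `s ≥ 0`, and there exists `C > 0` with
`y(s) ≤ C·z(s)` for all `s ≥ 0`. -/
theorem stmt_15 (σ : ℝ) (hσ0 : 0 < σ) (hσ1 : σ ≤ 1)
    (z y : ℝ → ℝ)
    (hz : ∀ s : ℝ, z s = (1 + σ * s) ^ 2 / (1 + s) ^ (4 - 2 * σ))
    (hy : ∀ s : ℝ, y s = Real.exp (-s ^ 2 / 2) * ∫ t in (0 : ℝ)..s, Real.exp (t ^ 2 / 2) * z t) :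
    (∀ s : ℝ, 0 ≤ s → HasDerivAt y (z s - s * y s) s) ∧
    ∃ C : ℝ, 0 < C ∧ ∀ s : ℝ, 0 ≤ s → y s ≤ C * z s := by
  have hpos : ∀ s : ℝ, -1 < s → 0 < 1 + σ * s := fun s hs => by nlinarith
  have hzd : ∀ s : ℝ, -1 < s →
      HasDerivAt z (z s * (2 * σ / (1 + σ * s) - (4 - 2 * σ) / (1 + s))) s := fun s hs => by
    rw [hz s, funext hz]
    exact hasDerivAt_sq_div_rpow (hpos s hs) (by linarith)
  have hzpos : ∀ s : ℝ, -1 < s → 0 < z s := fun s hs => by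
    rw [hz s]
    exact div_pos (pow_pos (hpos s hs) 2) (Real.rpow_pos_of_pos (by linarith) _)
  have hzc : ContinuousOn z (Ioi (-1)) := fun s hs => (hzd s hs).continuousAt.continuousWithinAt
  have hyd : ∀ s : ℝ, 0 ≤ s → HasDerivAt y (z s - s * y s) s := fun s hs => by
    rw [hy s, funext hy]
    exact hasDerivAt_exp_mul_integral hzc (by norm_num) (by linarith)
  refine ⟨hyd, ?_⟩
  have hquot : ContinuousOn (fun s => y s / z s) (Icc 0 3) := fun s hs =>
    ((hyd s hs.1).continuousAt.div (hzd s (by linarith [hs.1])).continuousAt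
      (hzpos s (by linarith [hs.1])).ne').continuousWithinAt
  obtain ⟨M, hM⟩ := isCompact_Icc.bddAbove_image hquot
  have hC : 1 ≤ max M 1 := le_max_right _ _
  have hsmall : ∀ s : ℝ, 0 ≤ s → s ≤ 3 → y s ≤ max M 1 * z s := fun s h0 h3 =>
    (div_le_iff₀ (hzpos s (by linarith))).1
      ((hM (mem_image_of_mem _ ⟨h0, h3⟩)).trans (le_max_left _ _))
  refine ⟨max M 1, by linarith, fun s hs => ?_⟩
  rcases le_total s 3 with h3 | h3
  · exact hsmall s hs h3
  refine le_of_hasDerivAt_add_mul_le (a := 3) (w := fun s => max M 1 * z s)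
    (fun t ht => hyd t (by linarith)) (fun t ht => (hzd t (by linarith)).const_mul (max M 1))
    (fun t ht => ?_) (hsmall 3 (by norm_num) le_rfl) h3
  have hzt := hzpos t (by linarith)
  have hnum : 0 ≤ 2 * σ / (1 + σ * t) := div_nonneg (by linarith) (hpos t (by linarith)).le
  have hden : (4 - 2 * σ) / (1 + t) ≤ 1 := (div_le_one (by linarith)).2 (by linarith)
  have hlog : 1 ≤ max M 1 * (2 * σ / (1 + σ * t) - (4 - 2 * σ) / (1 + t) + t) :=
    one_le_mul_of_one_le_of_one_le hC (by linarith)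
  nlinarith [mul_le_mul_of_nonneg_left hlog hzt.le]
end

section
/- Let τ ∈ (1/2, 1] and define ψ(t) = (1+t)^{τ-1}·(t/(1+t))^{1/2}, Ψ₁(t) = ∫₀^t ψ(s) ds and Ψ₂(t) = ∫₀^t ψ(s)² ds for t ≥ 0. Then there exists a constant C > 0 such that Ψ₂(t) ≤ C·ψ(t)·Ψ₁(t) for all t ≥ 0. -/
theorem profile_eq_rpow_mul_div_rpow (τ : ℝ) {s : ℝ} (hs : 0 < s) :
    (1 + s) ^ (τ - 1) * (s / (1 + s)) ^ ((1 : ℝ) / 2) =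
      s ^ (τ - 1) * (s / (1 + s)) ^ (3 / 2 - τ) := by
  have h1 : 0 < 1 + s := by linarith
  rw [show (1 : ℝ) / 2 = (τ - 1) + (3 / 2 - τ) by ring, Real.rpow_add (by positivity),
    ← mul_assoc, ← Real.mul_rpow h1.le (by positivity), mul_div_cancel₀ s h1.ne']

theorem profile_eq_sqrt_mul_rpow (τ : ℝ) {s : ℝ} (hs : 0 < s) :
    (1 + s) ^ (τ - 1) * (s / (1 + s)) ^ ((1 : ℝ) / 2) =
      s ^ ((1 : ℝ) / 2) * (1 + s) ^ (τ - 3 / 2) := by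
  have h1 : 0 < 1 + s := by linarith
  rw [Real.div_rpow hs.le h1.le, show τ - 3 / 2 = (τ - 1) - 1 / 2 by ring, Real.rpow_sub h1 (τ - 1)]
  ring

theorem profile_sq_le {τ s t : ℝ} (hτ : τ ≤ 1) (hs : 0 < s) (hst : s ≤ t) :
    ((1 + s) ^ (τ - 1) * (s / (1 + s)) ^ ((1 : ℝ) / 2)) ^ 2 ≤
      s ^ (2 * τ - 2) * ((t / (1 + t)) ^ (3 / 2 - τ)) ^ 2 := by
  have hd : s / (1 + s) ≤ t / (1 + t) := by
    rw [div_le_div_iff₀ (by linarith) (by linarith)]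
    nlinarith
  have hd0 : 0 ≤ s / (1 + s) := by positivity
  rw [profile_eq_rpow_mul_div_rpow τ hs, mul_pow,
    show 2 * τ - 2 = (τ - 1) * (2 : ℕ) by push_cast; ring, Real.rpow_mul_natCast hs.le]
  have := Real.rpow_le_rpow hd0 hd (by linarith : 0 ≤ 3 / 2 - τ)
  gcongr

theorem sqrt_mul_rpow_le_profile {τ s t : ℝ} (hτ : τ ≤ 1) (hs : 0 < s) (hst : s ≤ t) :
    s ^ ((1 : ℝ) / 2) * (1 + t) ^ (τ - 3 / 2) ≤
      (1 + s) ^ (τ - 1) * (s / (1 + s)) ^ ((1 : ℝ) / 2) := by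
  rw [profile_eq_sqrt_mul_rpow τ hs]
  have := Real.rpow_le_rpow_of_nonpos (by linarith : 0 < 1 + s)
    (by linarith : 1 + s ≤ 1 + t) (by linarith : τ - 3 / 2 ≤ 0)
  gcongr

theorem continuousOn_profile (τ : ℝ) :
    ContinuousOn (fun s : ℝ => (1 + s) ^ (τ - 1) * (s / (1 + s)) ^ ((1 : ℝ) / 2))
      (Set.Ici 0) := by
  have h : ∀ s ∈ Set.Ici (0 : ℝ), 1 + s ≠ 0 := fun s hs => by
    have : (0 : ℝ) ≤ s := hs
    positivity
  have hc : ContinuousOn (fun s : ℝ => 1 + s) (Set.Ici 0) := by fun_prop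
  exact (hc.rpow_const fun s hs => Or.inl (h s hs)).mul
    ((continuousOn_id.div hc h).rpow_const fun s _ => Or.inr (by norm_num))


/-- Let `τ ∈ (1/2,1]`, `ψ(t) = (1+t)^{τ-1}·(t/(1+t))^{1/2}`,
`Ψ₁(t) = ∫₀^t ψ(s) ds` and `Ψ₂(t) = ∫₀^t ψ(s)² ds` for `t ≥ 0`. Then there exists
`C > 0` such that `Ψ₂(t) ≤ C·ψ(t)·Ψ₁(t)` for all `t ≥ 0`. -/
theorem stmt_16 (τ : ℝ) (hτ0 : 1 / 2 < τ) (hτ1 : τ ≤ 1)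
    (ψ Ψ₁ Ψ₂ : ℝ → ℝ)
    (hψ : ∀ t : ℝ, ψ t = (1 + t) ^ (τ - 1) * (t / (1 + t)) ^ ((1 : ℝ) / 2))
    (hΨ₁ : ∀ t : ℝ, Ψ₁ t = ∫ s in (0 : ℝ)..t, ψ s)
    (hΨ₂ : ∀ t : ℝ, Ψ₂ t = ∫ s in (0 : ℝ)..t, (ψ s) ^ 2) :
    ∃ C : ℝ, 0 < C ∧ ∀ t : ℝ, 0 ≤ t → Ψ₂ t ≤ C * ψ t * Ψ₁ t := by
  obtain rfl : ψ = fun t => (1 + t) ^ (τ - 1) * (t / (1 + t)) ^ ((1 : ℝ) / 2) := funext hψ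
  have hpos : 0 < 2 * τ - 1 := by linarith
  refine ⟨3 / (2 * (2 * τ - 1)), by positivity, fun t ht => ?_⟩
  rw [hΨ₁, hΨ₂]
  rcases ht.eq_or_lt with rfl | ht
  · simp
  have hcont : ContinuousOn (fun s : ℝ => (1 + s) ^ (τ - 1) * (s / (1 + s)) ^ ((1 : ℝ) / 2))
      (Set.uIcc 0 t) :=
    (continuousOn_profile τ).mono (by rw [Set.uIcc_of_le ht.le]; exact Set.Icc_subset_Ici_self)
  have lower : t * ((1 + t) ^ (τ - 1) * (t / (1 + t)) ^ ((1 : ℝ) / 2)) * (2 / 3) ≤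
      ∫ s in (0 : ℝ)..t, (1 + s) ^ (τ - 1) * (s / (1 + s)) ^ ((1 : ℝ) / 2) := by
    calc _ = ∫ s in (0 : ℝ)..t, s ^ ((1 : ℝ) / 2) * (1 + t) ^ (τ - 3 / 2) := by
          rw [intervalIntegral.integral_mul_const, integral_rpow (Or.inl (by norm_num)),
            Real.zero_rpow (by norm_num), Real.rpow_add_one ht.ne',
            profile_eq_sqrt_mul_rpow τ ht]
          ring
      _ ≤ _ := intervalIntegral.integral_mono_on_of_le_Ioo ht.le
          ((intervalIntegral.intervalIntegrable_rpow' (by norm_num)).mul_const _)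
          hcont.intervalIntegrable
          fun s hs => sqrt_mul_rpow_le_profile hτ1 hs.1 hs.2.le
  have upper : ∫ s in (0 : ℝ)..t, ((1 + s) ^ (τ - 1) * (s / (1 + s)) ^ ((1 : ℝ) / 2)) ^ 2 ≤
      t * ((1 + t) ^ (τ - 1) * (t / (1 + t)) ^ ((1 : ℝ) / 2)) ^ 2 / (2 * τ - 1) := by
    calc _ ≤ ∫ s in (0 : ℝ)..t, s ^ (2 * τ - 2) * ((t / (1 + t)) ^ (3 / 2 - τ)) ^ 2 :=
          intervalIntegral.integral_mono_on_of_le_Ioo ht.le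
            (hcont.pow 2).intervalIntegrable
            ((intervalIntegral.intervalIntegrable_rpow' (by linarith)).mul_const _)
            fun s hs => profile_sq_le hτ1 hs.1 hs.2.le
      _ = _ := by
          rw [intervalIntegral.integral_mul_const, integral_rpow (Or.inl (by linarith)),
            Real.zero_rpow (by linarith), Real.rpow_add_one ht.ne',
            profile_eq_rpow_mul_div_rpow τ ht, mul_pow, ← Real.rpow_mul_natCast ht.le,
            show (τ - 1) * ((2 : ℕ) : ℝ) = 2 * τ - 2 by push_cast; ring,
            show 2 * τ - 2 + 1 = 2 * τ - 1 by ring]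
          ring
  refine upper.trans ?_
  have hnonneg : 0 ≤ (1 + t) ^ (τ - 1) * (t / (1 + t)) ^ ((1 : ℝ) / 2) := by positivity
  calc _ = 3 / (2 * (2 * τ - 1)) * ((1 + t) ^ (τ - 1) * (t / (1 + t)) ^ ((1 : ℝ) / 2)) *
        (t * ((1 + t) ^ (τ - 1) * (t / (1 + t)) ^ ((1 : ℝ) / 2)) * (2 / 3)) := by
        field_simp
    _ ≤ _ := mul_le_mul_of_nonneg_left lower (by positivity)
end

section
/- Let τ ∈ (1/2, 1] and define ψ(t) = (1+t)^{τ-1}·(t/(1+t))^{1/2}, Ψ₁(t) = ∫₀^t ψ(s) ds and Ψ₂(t) = ∫₀^t ψ(s)² ds for t ≥ 0. Then there exists a constant C > 0 such that Ψ₂(t) ≤ C·Ψ₁(t)^{(2τ-1)/τ} for all t ≥ 0. -/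
open Set intervalIntegral in
/-- The fundamental theorem of calculus for the primitive based at `0` of a function continuous
on `(-1, ∞)`, at nonnegative points. -/
lemma hasDerivAt_primitive_of_continuousOn_Ioi {f : ℝ → ℝ} (hf : ContinuousOn f (Ioi (-1)))
    {t : ℝ} (ht : 0 ≤ t) : HasDerivAt (fun u => ∫ s in (0 : ℝ)..u, f s) (f t) t := by
  have ht' : t ∈ Ioi (-1 : ℝ) := by simp only [mem_Ioi]; linarith
  refine integral_hasDerivAt_right ?_ (hf.stronglyMeasurableAtFilter isOpen_Ioi t ht')
    (hf.continuousAt (isOpen_Ioi.mem_nhds ht'))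
  refine (hf.mono fun x hx => ?_).intervalIntegrable
  rw [uIcc_of_le ht] at hx
  simp only [mem_Ioi]
  linarith [hx.1]

/-- The weight `(1+t)^(τ-1) (t/(1+t))^(1/2)` is continuous on `(-1, ∞)`. -/
lemma continuousOn_weight (τ : ℝ) :
    ContinuousOn (fun t : ℝ => (1 + t) ^ (τ - 1) * (t / (1 + t)) ^ ((1 : ℝ) / 2))
      (Set.Ioi (-1)) := by
  have hne : ∀ t ∈ Set.Ioi (-1 : ℝ), 1 + t ≠ 0 := fun t ht => by
    simp only [Set.mem_Ioi] at ht
    linarith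
  have h1 : ContinuousOn (fun t : ℝ => 1 + t) (Set.Ioi (-1)) := by fun_prop
  exact (h1.rpow_const fun t ht => Or.inl (hne t ht)).mul
    ((continuousOn_id.div h1 hne).rpow_const fun t _ => Or.inr (by norm_num))

/-- The weight `(1+t)^(τ-1) (t/(1+t))^(1/2)` is at most `t^(τ-1)` when `τ ≤ 1`. -/
lemma weight_le_rpow {τ t : ℝ} (hτ : τ ≤ 1) (ht : 0 < t) :
    (1 + t) ^ (τ - 1) * (t / (1 + t)) ^ ((1 : ℝ) / 2) ≤ t ^ (τ - 1) := by
  have h1 : 0 < 1 + t := by linarith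
  calc (1 + t) ^ (τ - 1) * (t / (1 + t)) ^ ((1 : ℝ) / 2)
      ≤ (1 + t) ^ (τ - 1) * 1 := by
        gcongr
        exact Real.rpow_le_one (by positivity) ((div_le_one h1).2 (by linarith)) (by norm_num)
    _ ≤ t ^ (τ - 1) := by
        rw [mul_one]
        exact Real.rpow_le_rpow_of_nonpos ht (by linarith) (by linarith)


/-- Let `τ ∈ (1/2,1]`, `ψ(t) = (1+t)^{τ-1}·(t/(1+t))^{1/2}`,
`Ψ₁(t) = ∫₀^t ψ(s) ds` and `Ψ₂(t) = ∫₀^t ψ(s)² ds` for `t ≥ 0`. Then there exists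
`C > 0` such that `Ψ₂(t) ≤ C·Ψ₁(t)^{(2τ-1)/τ}` for all `t ≥ 0`. -/
theorem stmt_17 (τ : ℝ) (hτ0 : 1 / 2 < τ) (hτ1 : τ ≤ 1)
    (ψ Ψ₁ Ψ₂ : ℝ → ℝ)
    (hψ : ∀ t : ℝ, ψ t = (1 + t) ^ (τ - 1) * (t / (1 + t)) ^ ((1 : ℝ) / 2))
    (hΨ₁ : ∀ t : ℝ, Ψ₁ t = ∫ s in (0 : ℝ)..t, ψ s)
    (hΨ₂ : ∀ t : ℝ, Ψ₂ t = ∫ s in (0 : ℝ)..t, (ψ s) ^ 2) :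
    ∃ C : ℝ, 0 < C ∧ ∀ t : ℝ, 0 ≤ t → Ψ₂ t ≤ C * Ψ₁ t ^ ((2 * τ - 1) / τ) := by
  have hψ' : ψ = fun t => (1 + t) ^ (τ - 1) * (t / (1 + t)) ^ ((1 : ℝ) / 2) := funext hψ
  have hcont : ContinuousOn ψ (Set.Ioi (-1)) := hψ' ▸ continuousOn_weight τ
  have hpos : ∀ t, 0 < t → 0 < ψ t := fun t ht => by rw [hψ]; positivity
  have hle : ∀ t, 0 < t → ψ t ≤ t ^ (τ - 1) := fun t ht => by
    rw [hψ]
    exact weight_le_rpow hτ1 ht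
  have hd₁ : ∀ t, 0 ≤ t → HasDerivAt Ψ₁ (ψ t) t := fun t ht => by
    rw [show Ψ₁ = _ from funext hΨ₁]
    exact hasDerivAt_primitive_of_continuousOn_Ioi hcont ht
  have hd₂ : ∀ t, 0 ≤ t → HasDerivAt Ψ₂ (ψ t ^ 2) t := fun t ht => by
    rw [show Ψ₂ = _ from funext hΨ₂]
    exact hasDerivAt_primitive_of_continuousOn_Ioi (hcont.pow 2) ht
  have hint : ∀ t, 0 ≤ t → IntervalIntegrable ψ MeasureTheory.volume 0 t := fun t ht => by
    refine (hcont.mono fun x hx => ?_).intervalIntegrable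
    rw [Set.uIcc_of_le ht] at hx
    simp only [Set.mem_Ioi]
    linarith [hx.1]
  have hΨ₁pos : ∀ t, 0 < t → 0 < Ψ₁ t := fun t ht => by
    rw [hΨ₁]
    exact intervalIntegral.intervalIntegral_pos_of_pos_on (hint t ht.le)
      (fun x hx => hpos x hx.1) ht
  have hτpos : 0 < τ := by linarith
  have hΨ₁le : ∀ t, 0 < t → Ψ₁ t ≤ t ^ τ / τ := fun t ht => by
    have h := intervalIntegral.integral_mono_on_of_le_Ioo ht.le (hint t ht.le)
      (intervalIntegral.intervalIntegrable_rpow' (by linarith : -1 < τ - 1))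
      (fun x hx => hle x hx.1)
    rw [integral_rpow (Or.inl (by linarith)), sub_add_cancel, Real.zero_rpow hτpos.ne',
      sub_zero] at h
    rwa [hΨ₁]
  set p := (2 * τ - 1) / τ with hp
  have hppos : 0 < p := div_pos (by linarith) hτpos
  have hτp : τ * (p - 1) = τ - 1 := by
    rw [hp]
    field_simp
    ring
  have hp1 : p - 1 ≤ 0 := by
    rw [hp, sub_nonpos, div_le_one hτpos]
    linarith
  have hpow : ∀ t, 0 < t → t ^ (τ - 1) ≤ τ ^ (p - 1) * Ψ₁ t ^ (p - 1) := fun t ht => by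
    have h := Real.rpow_le_rpow_of_nonpos (hΨ₁pos t ht) (hΨ₁le t ht) hp1
    rw [Real.div_rpow (by positivity) hτpos.le, ← Real.rpow_mul ht.le, hτp,
      div_le_iff₀ (by positivity)] at h
    linarith
  refine ⟨τ ^ (p - 1) / p, by positivity, fun t ht => ?_⟩
  have hmono : MonotoneOn (fun u => τ ^ (p - 1) / p * Ψ₁ u ^ p - Ψ₂ u) (Set.Ici 0) := by
    refine monotoneOn_of_hasDerivWithinAt_nonneg
      (f' := fun u => τ ^ (p - 1) / p * (ψ u * p * Ψ₁ u ^ (p - 1)) - ψ u ^ 2)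
      (convex_Ici 0) (fun u hu => ?_) (fun u hu => ?_) (fun u hu => ?_)
    · exact (((hd₁ u hu).continuousAt.rpow_const (Or.inr hppos.le)).const_mul _ |>.sub
        (hd₂ u hu).continuousAt).continuousWithinAt
    · rw [interior_Ici] at hu
      exact ((((hd₁ u hu.le).rpow_const (Or.inl (hΨ₁pos u hu).ne')).const_mul _).sub
        (hd₂ u hu.le)).hasDerivWithinAt
    · rw [interior_Ici] at hu
      have h := mul_le_mul_of_nonneg_left ((hle u hu).trans (hpow u hu)) (hpos u hu).le
      have heq : τ ^ (p - 1) / p * (ψ u * p * Ψ₁ u ^ (p - 1)) =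
          ψ u * (τ ^ (p - 1) * Ψ₁ u ^ (p - 1)) := by
        field_simp
      rw [heq, sub_nonneg, sq]
      exact h
  have h := hmono Set.self_mem_Ici ht ht
  simp only [hΨ₁ 0, hΨ₂ 0, intervalIntegral.integral_same, Real.zero_rpow hppos.ne', mul_zero,
    sub_zero] at h
  exact sub_nonneg.1 h
end
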